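/- Let u be the Hilbert function of a closed projective subscheme with Hilbert polynomial p(z) and regularity rho >= 1, and suppose u(rho-1) > p(rho-1). Then every closed projective subscheme with Hilbert function u has Castelnuovo-Mumford regularity strictly greater than rho+1; equivalently, m_u >= rho+2, i.e. every saturated strongly stable ideal J with H_{S/J} = u satisfies reg(J) > rho+1. -/

import Mathlib

open scoped Classical

noncomputable section

/-! ## Binomial expansions and the Macaulay operations `(a_t)^+_+` and `(a_t)^-_-` -/

/-- The largest `k` such that `C(k,t) ≤ a` (top coefficient of the greedy binomial
expansion of `a` in base `t`). -/
def expTop (a t : ℕ) : ℕ := Nat.findGreatest (fun k => Nat.choose k t ≤ a) (a + t + 1)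

/-- `(a_t)^+_+` : if `a = C(k(t),t) + ... + C(k(j),j)` is the binomial expansion of `a`
in base `t`, then `plusPlus a t = C(k(t)+1,t+1) + ... + C(k(j)+1,j+1)`; it sends `0` to `0`. -/
def plusPlus : ℕ → ℕ → ℕ
  | _, 0 => 0
  | a, t + 1 =>
    if a = 0 then 0
    else Nat.choose (expTop a (t + 1) + 1) (t + 2) +
      plusPlus (a - Nat.choose (expTop a (t + 1)) (t + 1)) t

/-- `(a_t)^-_-` : if `a = C(k(t),t) + ... + C(k(j),j)` is the binomial expansion of `a`
in base `t`, then `minusMinus a t = C(k(t)-1,t-1) + ... + C(k(j)-1,j-1)`; it sends `0` to `0`. -/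
def minusMinus : ℕ → ℕ → ℕ
  | _, 0 => 0
  | a, t + 1 =>
    if a = 0 then 0
    else Nat.choose (expTop a (t + 1) - 1) t +
      minusMinus (a - Nat.choose (expTop a (t + 1)) (t + 1)) t

/-! ## Numerical functions -/

/-- A numerical function (modelled with values in `ℤ`) is *admissible* (an O-sequence) if it is
nonnegative, `H 0 = 1` and `H (t+1) ≤ (H(t)_t)^+_+` for every `t ≥ 1`. -/
def OSeq (H : ℕ → ℤ) : Prop :=
  (∀ t, 0 ≤ H t) ∧ H 0 = 1 ∧ ∀ t, 1 ≤ t → H (t + 1) ≤ (plusPlus (H t).toNat t : ℤ)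

/-- First derivative of a numerical function: `Δf(0) = 1`, `Δf(t) = f(t) - f(t-1)`. -/
def nderiv (f : ℕ → ℤ) : ℕ → ℤ
  | 0 => 1
  | t + 1 => f (t + 1) - f t

/-- Integral of a numerical function: `Σg(0) = 1`, `Σg(t) = Σg(t-1) + g(t)`. -/
def ninteg (g : ℕ → ℤ) : ℕ → ℤ
  | 0 => 1
  | t + 1 => ninteg g t + g (t + 1)

/-! ## Admissible Hilbert polynomials in Gotzmann form -/

/-- The integer-valued binomial coefficient `C(a,k)` for `a : ℤ`, agreeing with the
polynomial binomial coefficient `a(a-1)⋯(a-k+1)/k!`. -/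
def zchoose (a : ℤ) (k : ℕ) : ℤ :=
  if 0 ≤ a then (a.toNat.choose k : ℤ)
  else (-1) ^ k * (((k : ℤ) - 1 - a).toNat.choose k : ℤ)

/-- An admissible Hilbert polynomial, recorded through its Gotzmann form
`p(z) = C(z+k₁,k₁) + C(z+k₂-1,k₂) + ... + C(z+k_r-(r-1),k_r)` with `k₁ ≥ k₂ ≥ ... ≥ k_r ≥ 0`. -/
structure GotzmannPoly where
  ks : List ℕ
  sorted : ks.Pairwise (· ≥ ·)

namespace GotzmannPoly

/-- The Gotzmann number `r` of `p`. -/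
def r (p : GotzmannPoly) : ℕ := p.ks.length

/-- The degree of `p`, namely `k₁`. -/
def degree (p : GotzmannPoly) : ℕ := p.ks.headD 0

/-- Evaluation of `p` at an integer. -/
def eval (p : GotzmannPoly) (z : ℤ) : ℤ :=
  ∑ i ∈ Finset.range p.r, zchoose (z + (p.ks.getD i 0 : ℤ) - i) (p.ks.getD i 0)

/-- The first difference `Δp(z) = p(z) - p(z-1)`, in Gotzmann form. -/
def delta (p : GotzmannPoly) : GotzmannPoly where
  ks := (p.ks.filter fun k => 1 ≤ k).map fun k => k - 1
  sorted := by
    refine List.Pairwise.map _ (fun {a b} h => Nat.sub_le_sub_right h 1) ?_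
    exact p.sorted.filter _

/-- Iterated first difference `Δ^i p`. -/
def deltaIter (p : GotzmannPoly) (i : ℕ) : GotzmannPoly := delta^[i] p

/-- The polynomial `p(z) + c`, in Gotzmann form. -/
def addConst (p : GotzmannPoly) (c : ℕ) : GotzmannPoly where
  ks := p.ks ++ List.replicate c 0
  sorted := by
    rw [List.pairwise_append]
    refine ⟨p.sorted, ?_, ?_⟩
    · exact List.pairwise_replicate.2 (Or.inr le_rfl)
    · intro a _ b hb
      rw [List.eq_of_mem_replicate hb]
      exact Nat.zero_le a

end GotzmannPoly

/-- The set `Π_p = {1 ≤ t ≤ r : (p(t+h)_{t+h})^+_+ ≥ p(t+h+1) ≥ 1 for all h ≥ 0}`. -/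
def PiSet (p : GotzmannPoly) : Set ℕ :=
  {t | 1 ≤ t ∧ t ≤ p.r ∧ ∀ h : ℕ,
      p.eval ((t : ℤ) + (h : ℤ) + 1) ≤ (plusPlus (p.eval ((t : ℤ) + (h : ℤ))).toNat (t + h) : ℤ) ∧
      1 ≤ p.eval ((t : ℤ) + (h : ℤ) + 1)}

/-- `ρ_p`: `0` if `min Π_p = 1` and `p(0) = 1`, and `min Π_p` otherwise. -/
def rhoP (p : GotzmannPoly) : ℕ :=
  if sInf (PiSet p) = 1 ∧ p.eval 0 = 1 then 0 else sInf (PiSet p)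

/-- The minimal function `f^ρ_p` : `f(t) = p(t)` for `t ≥ ρ` and
`f(t) = ((f(t+1))_{t+1})^-_-` for `t < ρ`. -/
def fmin (p : GotzmannPoly) (ρ : ℕ) (t : ℕ) : ℤ :=
  if h : ρ ≤ t then p.eval (t : ℤ)
  else (minusMinus (fmin p ρ (t + 1)).toNat (t + 1) : ℤ)
termination_by ρ - t
decreasing_by omega

/-- The function `g^ρ_p` : `g(t) = p(t)` for `t ≥ ρ`, `g(ρ-1) = p(ρ-1) + 1` and
`g(t) = ((g(t+1))_{t+1})^-_-` for `t < ρ-1`. -/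
def gmin (p : GotzmannPoly) (ρ : ℕ) (t : ℕ) : ℤ :=
  if h : ρ ≤ t then p.eval (t : ℤ)
  else if t = ρ - 1 then p.eval (t : ℤ) + 1
  else (minusMinus (gmin p ρ (t + 1)).toNat (t + 1) : ℤ)
termination_by ρ - t
decreasing_by omega

/-- `H` has regularity `ρ` (with respect to the Hilbert polynomial `p`): `ρ` is the least
integer such that `H(t) = p(t)` for all `t ≥ ρ`. -/
def IsRegOf (p : GotzmannPoly) (H : ℕ → ℤ) (ρ : ℕ) : Prop :=
  (∀ t : ℕ, ρ ≤ t → H t = p.eval (t : ℤ)) ∧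
  ∀ ρ' : ℕ, (∀ t : ℕ, ρ' ≤ t → H t = p.eval (t : ℤ)) → ρ ≤ ρ'

/-- `H` has Hilbert polynomial `p`, i.e. eventually agrees with `p`. -/
def HasHP (p : GotzmannPoly) (H : ℕ → ℤ) : Prop :=
  ∃ N : ℕ, ∀ t : ℕ, N ≤ t → H t = p.eval (t : ℤ)

/-- `F(p,ρ)`: the set of Hilbert functions of closed projective subschemes (i.e. numerical
functions which are admissible together with their first derivative) with Hilbert
polynomial `p` and regularity `ρ`. -/
def Fset (p : GotzmannPoly) (ρ : ℕ) : Set (ℕ → ℤ) :=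
  {H | OSeq H ∧ OSeq (nderiv H) ∧ IsRegOf p H ρ}

/-- `ρ̄_p`: the minimal `ρ` such that `F(p,ρ)` is non-empty. -/
def rhobar (p : GotzmannPoly) : ℕ := sInf {ρ | (Fset p ρ).Nonempty}

/-! ## Monomial ideals in `K[x₀,…,xₙ]` (combinatorial model) -/

/-- Monomials of `K[x₀,…,xₙ]`, as exponent vectors. -/
abbrev Mon (n : ℕ) := Fin (n + 1) → ℕ

/-- Degree of a monomial. -/
def mdeg {n : ℕ} (m : Mon n) : ℕ := ∑ i, m i

/-- `T_t`, the set of terms of degree `t`. -/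
def Tset (n t : ℕ) : Set (Mon n) := {m | mdeg m = t}

/-- A set of monomials closed under multiplication by arbitrary monomials (a monomial ideal). -/
def MonIdeal {n : ℕ} (J : Set (Mon n)) : Prop :=
  ∀ m ∈ J, ∀ m' : Mon n, m + m' ∈ J

/-- The elementary Borel move sending `x^m` to `x_i · x^m / x_j`. -/
def borelStep {n : ℕ} (m : Mon n) (j i : Fin (n + 1)) : Mon n :=
  fun l => if l = j then m l - 1 else if l = i then m l + 1 else m l

/-- One elementary Borel move `x_j ↦ x_i` with `j < i`. -/
def borelMove {n : ℕ} (a b : Mon n) : Prop :=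
  ∃ j i : Fin (n + 1), j < i ∧ 1 ≤ a j ∧ b = borelStep a j i

/-- The Borel (partial) order `≤_B` on monomials. -/
def borelLE {n : ℕ} : Mon n → Mon n → Prop := Relation.ReflTransGen borelMove

/-- A strongly stable (Borel) monomial ideal. -/
def StronglyStable {n : ℕ} (J : Set (Mon n)) : Prop :=
  MonIdeal J ∧ ∀ m ∈ J, ∀ j i : Fin (n + 1), j < i → 1 ≤ m j → borelStep m j i ∈ J

/-- A Borel set in `T_t`: a set of degree-`t` monomials closed upwards under `≤_B`. -/
def IsBorelSet {n : ℕ} (t : ℕ) (B : Set (Mon n)) : Prop :=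
  B ⊆ Tset n t ∧ ∀ a ∈ B, ∀ b : Mon n, borelLE a b → b ∈ B

/-- Saturation of a monomial ideal:
`J^sat = {m : for every i there is k with x_i^k · m ∈ J}`. -/
def monSat {n : ℕ} (J : Set (Mon n)) : Set (Mon n) :=
  {m | ∀ i : Fin (n + 1), ∃ k : ℕ, (fun l => if l = i then m l + k else m l) ∈ J}

/-- The monomial ideal generated by a set of monomials. -/
def genIdeal {n : ℕ} (B : Set (Mon n)) : Set (Mon n) :=
  {m | ∃ b ∈ B, ∃ c : Mon n, m = b + c}

/-- The Hilbert function of `S/J` for a monomial ideal `J`: the number of degree-`t`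
monomials outside `J`. -/
def hilb {n : ℕ} (J : Set (Mon n)) (t : ℕ) : ℕ :=
  Set.ncard {m : Mon n | mdeg m = t ∧ m ∉ J}

/-- `m / x_i` as an exponent vector. -/
def shrinkAt {n : ℕ} (m : Mon n) (i : Fin (n + 1)) : Mon n :=
  fun l => if l = i then m l - 1 else m l

/-- `m` is a minimal (monomial) generator of the monomial ideal `J`. -/
def IsMinGen {n : ℕ} (J : Set (Mon n)) (m : Mon n) : Prop :=
  m ∈ J ∧ ∀ i : Fin (n + 1), 1 ≤ m i → shrinkAt m i ∉ J

/-- The Castelnuovo–Mumford regularity of a strongly stable ideal: the maximal degree of a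
minimal monomial generator. -/
def monReg {n : ℕ} (J : Set (Mon n)) : ℕ :=
  sSup {d | ∃ m : Mon n, IsMinGen J m ∧ mdeg m = d}

/-- `m_u`: the minimal Castelnuovo–Mumford regularity of a closed projective subscheme with
Hilbert function `u`, i.e. the minimum of `reg J` over all `n` and all saturated strongly
stable ideals `J ⊆ K[x₀,…,xₙ]` with `H_{S/J} = u`. -/
def mReg (u : ℕ → ℤ) : ℕ :=
  sInf {r | ∃ (n : ℕ) (J : Set (Mon n)), StronglyStable J ∧ monSat J = J ∧
      (∀ t : ℕ, (hilb J t : ℤ) = u t) ∧ monReg J = r}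

/-- `M(p,ρ) = {m_u : u ∈ F(p,ρ)}`. -/
def Mset (p : GotzmannPoly) (ρ : ℕ) : Set ℕ := {r | ∃ u ∈ Fset p ρ, mReg u = r}

/-- `m^ρ_p = min M(p,ρ)`. -/
def mRho (p : GotzmannPoly) (ρ : ℕ) : ℕ := sInf (Mset p ρ)

/-- `m_p`: the minimal Castelnuovo–Mumford regularity of schemes with Hilbert polynomial `p`. -/
def mP (p : GotzmannPoly) : ℕ := sInf {r | ∃ ρ : ℕ, ∃ u ∈ Fset p ρ, mReg u = r}

/-! ## Lex segments and growth-height-lexicographic Borel sets -/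

/-- `a` is smaller than `b` in the deglex order (for monomials of the same degree):
`a k < b k` where `k` is the largest index where they differ. -/
def deglexLT {n : ℕ} (a b : Mon n) : Prop :=
  ∃ k : Fin (n + 1), a k < b k ∧ ∀ l : Fin (n + 1), k < l → a l = b l

/-- A lex-segment of `T_t`: a set of degree-`t` monomials consisting of the highest terms
with respect to deglex. -/
def IsLexSeg {n : ℕ} (t : ℕ) (L : Set (Mon n)) : Prop :=
  L ⊆ Tset n t ∧ ∀ a ∈ L, ∀ b ∈ Tset n t, deglexLT a b → b ∈ L

/-- A lex-segment in `A ⊆ T_t`: the intersection of a lex-segment of `T_t` with `A`. -/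
def LexSegIn {n : ℕ} (t : ℕ) (A S : Set (Mon n)) : Prop :=
  ∃ L : Set (Mon n), IsLexSeg t L ∧ S = L ∩ A

/-- The growth class `B^{(i)} = {m ∈ B : min(m) = i}`. -/
def growthClass {n : ℕ} (B : Set (Mon n)) (i : Fin (n + 1)) : Set (Mon n) :=
  {m | m ∈ B ∧ 1 ≤ m i ∧ ∀ j : Fin (n + 1), j < i → m j = 0}

/-- The height class `B(i) = {m ∈ B : the exponent of x₀ in m is i}`. -/
def heightClass {n : ℕ} (B : Set (Mon n)) (i : ℕ) : Set (Mon n) :=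
  {m | m ∈ B ∧ m 0 = i}

/-- A Borel set `B ⊆ T_t` is growth-lexicographic if all its growth classes are lex-segments
in the corresponding growth classes of `T_t`. -/
def GrowthLex {n : ℕ} (t : ℕ) (B : Set (Mon n)) : Prop :=
  ∀ i : Fin (n + 1), LexSegIn t (growthClass (Tset n t) i) (growthClass B i)

/-- A Borel set `B ⊆ T_t` is growth-height-lexicographic if `B(0)` is growth-lexicographic
and `B(i)` is a lex-segment in `T_t(i)` for every `0 < i ≤ t`. -/
def GHLex {n : ℕ} (t : ℕ) (B : Set (Mon n)) : Prop :=
  GrowthLex t (heightClass B 0) ∧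
  ∀ i : ℕ, 0 < i → i ≤ t → LexSegIn t (heightClass (Tset n t) i) (heightClass B i)

end

/-- `H` has regularity `ρ` with respect to the polynomial `P ∈ ℚ[z]`: `ρ` is the least
integer such that `H(t) = P(t)` for all `t ≥ ρ`. -/
def IsRegPoly (P : Polynomial ℚ) (H : ℕ → ℤ) (ρ : ℕ) : Prop :=
  (∀ t : ℕ, ρ ≤ t → (H t : ℚ) = P.eval (t : ℚ)) ∧
  ∀ ρ' : ℕ, (∀ t : ℕ, ρ' ≤ t → (H t : ℚ) = P.eval (t : ℚ)) → ρ ≤ ρ'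

/-! ## The rank of a monomial in the lexicographic order -/

lemma choose_expTop_le {a t : ℕ} (ha : a ≠ 0) : (expTop a (t + 1)).choose (t + 1) ≤ a :=
  Nat.findGreatest_spec (P := fun k => Nat.choose k (t + 1) ≤ a) (m := t + 1) (by omega)
    (by simpa using Nat.one_le_iff_ne_zero.2 ha)

lemma lt_choose_add_two (a t : ℕ) : a < (a + t + 2).choose (t + 1) := by
  induction t with
  | zero => simp
  | succ t ih =>
    rw [show a + (t + 1) + 2 = (a + t + 2) + 1 by ring, Nat.choose_succ_succ']
    omega

lemma lt_choose_of_expTop_lt {a t k : ℕ} (hk : expTop a (t + 1) < k) :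
    a < k.choose (t + 1) := by
  rcases le_or_gt k (a + (t + 1) + 1) with h | h
  · exact not_le.1
      (Nat.findGreatest_is_greatest (P := fun k => Nat.choose k (t + 1) ≤ a) hk h)
  · exact (lt_choose_add_two a t).trans_le (Nat.choose_le_choose _ (by omega))

lemma plusPlus_le_of_lt_choose (t : ℕ) :
    ∀ b k : ℕ, b < k.choose t → plusPlus b t ≤ (k + 1).choose (t + 1) := by
  induction t with
  | zero => intro b k _; simp [plusPlus]
  | succ t ih =>
    intro b k hb
    rw [plusPlus]
    split_ifs with h
    · exact Nat.zero_le _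
    have h₁ := choose_expTop_le (t := t) h
    have h₂ := lt_choose_of_expTop_lt (Nat.lt_succ_self (expTop b (t + 1)))
    rw [Nat.choose_succ_succ'] at h₂
    have h₃ := ih (b - (expTop b (t + 1)).choose (t + 1)) (expTop b (t + 1)) (by omega)
    have hlt : expTop b (t + 1) < k := by
      by_contra hge
      exact absurd (Nat.choose_le_choose (t + 1) (not_lt.1 hge)) (by omega)
    have h₄ : (expTop b (t + 1) + 1 + 1).choose (t + 1 + 1) ≤ (k + 1).choose (t + 1 + 1) :=
      Nat.choose_le_choose _ (by omega)
    rw [Nat.choose_succ_succ'] at h₄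
    rw [show t + 2 = t + 1 + 1 from rfl]
    omega

/-- The number of monomials of degree `l.length` which are smaller in the lexicographic order
than the monomial whose variables are listed, in decreasing order, by `l`. -/
def lexRank : List ℕ → ℕ
  | [] => 0
  | e :: l => (e + l.length).choose (l.length + 1) + lexRank l

/-- The rank of the product of the smallest variable and the monomial listed by `l`. -/
def lexRankShift : List ℕ → ℕ
  | [] => 0
  | e :: l => (e + (l.length + 1)).choose (l.length + 1 + 1) + lexRankShift l

lemma lexRank_lt {l : List ℕ} (hl : l.Pairwise (· ≥ ·)) :
    ∀ {e : ℕ}, (∀ a ∈ l, a ≤ e) → lexRank l < (e + l.length).choose l.length := by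
  induction l with
  | nil => intro e _; simp [lexRank]
  | cons a l ih =>
    intro e he
    rw [List.pairwise_cons] at hl
    have h₁ := ih hl.2 hl.1
    have h₂ : (a + l.length + 1).choose (l.length + 1) ≤
        (e + (l.length + 1)).choose (l.length + 1) :=
      Nat.choose_le_choose _ (by have := he a (by simp); omega)
    rw [Nat.choose_succ_succ'] at h₂
    simp only [lexRank, List.length_cons] at *
    omega

lemma lexRankShift_lt {l : List ℕ} (hl : l.Pairwise (· ≥ ·)) :
    ∀ {e : ℕ}, (∀ a ∈ l, a ≤ e) →
      lexRankShift l < (e + 1 + l.length).choose (l.length + 1) := by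
  induction l with
  | nil => intro e _; simp [lexRankShift]
  | cons a l ih =>
    intro e he
    rw [List.pairwise_cons] at hl
    have h₁ := ih hl.2 hl.1
    have h₂ : (a + l.length + 1 + 1).choose (l.length + 1 + 1) ≤
        (e + 1 + (l.length + 1)).choose (l.length + 1 + 1) :=
      Nat.choose_le_choose _ (by have := he a (by simp); omega)
    rw [Nat.choose_succ_succ', show a + l.length + 1 = a + 1 + l.length by ring] at h₂
    simp only [lexRankShift, List.length_cons] at *
    rw [show a + (l.length + 1) = a + 1 + l.length by ring]
    omega

lemma plusPlus_le_lexRankShift {l : List ℕ} (hl : l.Pairwise (· ≥ ·)) :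
    ∀ {a : ℕ}, a ≤ lexRank l → plusPlus a l.length ≤ lexRankShift l := by
  induction l with
  | nil => intro a _; simp [plusPlus]
  | cons e l ih =>
    intro a ha
    have hlt : lexRank (e :: l) < (e + (l.length + 1)).choose (l.length + 1) :=
      lexRank_lt hl (by
        intro b hb
        rcases List.mem_cons.1 hb with rfl | hb
        · exact le_rfl
        · exact (List.pairwise_cons.1 hl).1 b hb)
    rw [List.length_cons, plusPlus]
    split_ifs with h
    · exact Nat.zero_le _
    have h₁ := choose_expTop_le (t := l.length) h
    have h₂ := lt_choose_of_expTop_lt (Nat.lt_succ_self (expTop a (l.length + 1)))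
    rw [Nat.choose_succ_succ'] at h₂
    simp only [lexRank, lexRankShift, show l.length + 2 = l.length + 1 + 1 from rfl] at *
    generalize expTop a (l.length + 1) = k at *
    rcases lt_trichotomy (e + l.length) k with hk | hk | hk
    · have := Nat.choose_le_choose (l.length + 1) (show e + (l.length + 1) ≤ k by omega)
      omega
    · subst hk
      have := ih (List.pairwise_cons.1 hl).2 (a := a - (e + l.length).choose (l.length + 1))
        (by omega)
      rw [← add_assoc]
      omega
    · have h₃ := plusPlus_le_of_lt_choose l.length (a - k.choose (l.length + 1)) k (by omega)
      have h₄ := Nat.choose_le_choose (l.length + 1 + 1) (show k + 1 + 1 ≤ e + (l.length + 1) by omega)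
      rw [Nat.choose_succ_succ'] at h₄
      omega

lemma lexRankShift_le_lexRank_orderedInsert {l : List ℕ} (hl : l.Pairwise (· ≥ ·)) (e : ℕ) :
    lexRankShift l ≤ lexRank (l.orderedInsert (· ≥ ·) e) := by
  induction l with
  | nil => exact Nat.zero_le _
  | cons a l ih =>
    rw [List.orderedInsert_cons]
    split_ifs with h
    · rcases eq_or_lt_of_le (show a ≤ e from h) with rfl | h
      · have := ih (List.pairwise_cons.1 hl).2
        have hins : l.orderedInsert (· ≥ ·) a = a :: l := by
          cases l with
          | nil => rfl
          | cons b l => exact List.orderedInsert_cons_of_le _ _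
                          ((List.pairwise_cons.1 hl).1 b (by simp))
        rw [hins] at this
        simp only [lexRank, lexRankShift, List.length_cons] at *
        omega
      · have h₁ := lexRankShift_lt hl (e := a) (by
          intro b hb
          rcases List.mem_cons.1 hb with rfl | hb
          · exact le_rfl
          · exact (List.pairwise_cons.1 hl).1 b hb)
        have h₂ := Nat.choose_le_choose (l.length + 1 + 1)
          (show a + 1 + (l.length + 1) ≤ e + (l.length + 1) by omega)
        simp only [lexRank, List.length_cons] at *
        omega
    · have := ih (List.pairwise_cons.1 hl).2
      simp only [lexRank, lexRankShift, List.orderedInsert_length]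
      omega

lemma lexRank_orderedInsert_le {l : List ℕ} (hl : l.Pairwise (· ≥ ·)) {e e' : ℕ}
    (he : e ≤ e') :
    lexRank (l.orderedInsert (· ≥ ·) e) ≤ lexRank (l.orderedInsert (· ≥ ·) e') := by
  induction l with
  | nil => simpa [lexRank] using he
  | cons a l ih =>
    have hl' := List.pairwise_cons.1 hl
    rw [List.orderedInsert_cons, List.orderedInsert_cons]
    split_ifs with h h' h'
    · simp only [lexRank, List.length_cons]
      have := Nat.choose_le_choose (l.length + 1 + 1)
          (show e + (l.length + 1) ≤ e' + (l.length + 1) by omega)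
      omega
    · omega
    · have h₁ := lexRank_lt (hl'.2.orderedInsert (r := (· ≥ ·)) e l) (e := a) (by
        intro b hb
        rcases (List.mem_orderedInsert _).1 hb with rfl | hb
        · exact (not_le.1 h).le
        · exact hl'.1 b hb)
      rcases eq_or_lt_of_le (show a ≤ e' from h') with rfl | h'
      · have := ih hl'.2
        have hins : l.orderedInsert (· ≥ ·) a = a :: l := by
          cases l with
          | nil => rfl
          | cons b l => exact List.orderedInsert_cons_of_le _ _ (hl'.1 b (by simp))
        rw [hins] at this
        simp only [lexRank, List.length_cons, List.orderedInsert_length] at *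
        omega
      · have h₂ := Nat.choose_le_choose (l.length + 1 + 1)
          (show a + (l.length + 1) + 1 ≤ e' + (l.length + 1) by omega)
        rw [Nat.choose_succ_succ'] at h₂
        simp only [lexRank, List.length_cons, List.orderedInsert_length] at *
        omega
    · have := ih hl'.2
      simp only [lexRank, List.orderedInsert_length]
      omega

lemma lexRank_injective {l : List ℕ} (hl : l.Pairwise (· ≥ ·)) :
    ∀ {l' : List ℕ}, l'.Pairwise (· ≥ ·) → l.length = l'.length → lexRank l = lexRank l' →
      l = l' := by
  have key : ∀ {a b : ℕ} {l l' : List ℕ}, (a :: l).Pairwise (· ≥ ·) → l.length = l'.length →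
      a < b → lexRank (a :: l) < lexRank (b :: l') := by
    intro a b l l' h hlen hab
    have h₁ := lexRank_lt h (e := a) (by
      intro c hc
      rcases List.mem_cons.1 hc with rfl | hc
      · exact le_rfl
      · exact (List.pairwise_cons.1 h).1 c hc)
    have h₂ := Nat.choose_le_choose (l.length + 1)
      (show a + (l.length + 1) ≤ b + l'.length by omega)
    simp only [lexRank, List.length_cons] at *
    rw [← hlen] at *
    omega
  induction l with
  | nil => intro l' _ h _; exact (List.length_eq_zero_iff.1 h.symm).symm
  | cons a l ih =>
    intro l' hl' hlen h
    cases l' with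
    | nil => simp at hlen
    | cons b l' =>
      have hlen' : l.length = l'.length := by simpa using hlen
      rcases lt_trichotomy a b with hab | rfl | hab
      · exact absurd h (key hl hlen' hab).ne
      · rw [ih (List.pairwise_cons.1 hl).2 (List.pairwise_cons.1 hl').2 hlen'
          (by simpa [lexRank, hlen'] using h)]
      · exact absurd h (key hl' hlen'.symm hab).ne'

lemma exists_lexRank_eq (t : ℕ) : ∀ e a : ℕ, a < (e + t).choose t →
    ∃ l : List ℕ, l.Pairwise (· ≥ ·) ∧ (∀ b ∈ l, b ≤ e) ∧ l.length = t ∧ lexRank l = a := by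
  induction t with
  | zero =>
    intro e a ha
    exact ⟨[], by simp, by simp, rfl, by simp at ha; simp [lexRank, ha]⟩
  | succ t iht =>
    have step : ∀ e a, (e + t).choose (t + 1) ≤ a → a < (e + (t + 1)).choose (t + 1) →
        ∃ l : List ℕ, l.Pairwise (· ≥ ·) ∧ (∀ b ∈ l, b ≤ e) ∧ l.length = t + 1 ∧
          lexRank l = a := by
      intro e a h₁ h₂
      rw [← add_assoc, Nat.choose_succ_succ'] at h₂
      obtain ⟨l, hl, hle, rfl, hr⟩ := iht e (a - (e + t).choose (t + 1)) (by
        omega)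
      refine ⟨e :: l, List.pairwise_cons.2 ⟨hle, hl⟩, ?_, rfl, ?_⟩
      · intro b hb
        rcases List.mem_cons.1 hb with rfl | hb
        · exact le_rfl
        · exact hle b hb
      · simp only [lexRank]; omega
    intro e
    induction e with
    | zero => intro a; exact step 0 a (by simp)
    | succ e ihe =>
      intro a ha
      rcases le_or_gt ((e + 1 + t).choose (t + 1)) a with h | h
      · exact step (e + 1) a h ha
      · obtain ⟨l, hl, hle, hlen, hr⟩ := ihe a (by rwa [show e + (t + 1) = e + 1 + t by ring])
        exact ⟨l, hl, fun b hb => (hle b hb).trans (Nat.le_succ e), hlen, hr⟩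

/-- The lexicographic rank of a monomial, given as the multiset of its variables. -/
def multisetRank (M : Multiset ℕ) : ℕ := lexRank (M.sort (· ≥ ·))

lemma sort_cons_eq_orderedInsert (e : ℕ) (M : Multiset ℕ) :
    (e ::ₘ M).sort (· ≥ ·) = (M.sort (· ≥ ·)).orderedInsert (· ≥ ·) e := by
  refine List.Perm.eq_of_pairwise' (r := (· ≥ ·)) (Multiset.pairwise_sort _ _)
    ((Multiset.pairwise_sort _ _).orderedInsert (r := (· ≥ ·)) e _) ?_
  refine List.Perm.trans ?_ (List.perm_orderedInsert _ _ _).symm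
  rw [← Multiset.coe_eq_coe, Multiset.sort_eq, ← Multiset.cons_coe, Multiset.sort_eq]

lemma le_multisetRank_cons {v : ℕ → ℕ} (h₀ : v 0 = 1)
    (hv : ∀ t, 1 ≤ t → v (t + 1) ≤ plusPlus (v t) t) {M : Multiset ℕ} (e : ℕ)
    (h : v M.card ≤ multisetRank M) : v (e ::ₘ M).card ≤ multisetRank (e ::ₘ M) := by
  rcases Multiset.empty_or_exists_mem M with rfl | ⟨a, ha⟩
  · simp [multisetRank, lexRank, h₀] at h
  have h₁ := plusPlus_le_lexRankShift (Multiset.pairwise_sort M (· ≥ ·)) h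
  rw [Multiset.length_sort] at h₁
  rw [multisetRank, sort_cons_eq_orderedInsert, Multiset.card_cons]
  exact ((hv _ (Multiset.card_pos_iff_exists_mem.2 ⟨a, ha⟩)).trans h₁).trans
    (lexRankShift_le_lexRank_orderedInsert (Multiset.pairwise_sort _ _) e)

lemma le_multisetRank_add {v : ℕ → ℕ} (h₀ : v 0 = 1)
    (hv : ∀ t, 1 ≤ t → v (t + 1) ≤ plusPlus (v t) t) {M : Multiset ℕ} (N : Multiset ℕ)
    (h : v M.card ≤ multisetRank M) : v (M + N).card ≤ multisetRank (M + N) := by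
  induction N using Multiset.induction_on with
  | empty => simpa using h
  | cons e N ih => rw [Multiset.add_cons]; exact le_multisetRank_cons h₀ hv e ih

lemma multisetRank_cons_mono (M : Multiset ℕ) {e e' : ℕ} (h : e ≤ e') :
    multisetRank (e ::ₘ M) ≤ multisetRank (e' ::ₘ M) := by
  rw [multisetRank, multisetRank, sort_cons_eq_orderedInsert, sort_cons_eq_orderedInsert]
  exact lexRank_orderedInsert_le (Multiset.pairwise_sort _ _) h

lemma multisetRank_injective {M N : Multiset ℕ} (hc : M.card = N.card)
    (h : multisetRank M = multisetRank N) : M = N := by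
  rw [← Multiset.sort_eq M (· ≥ ·), ← Multiset.sort_eq N (· ≥ ·),
    lexRank_injective (Multiset.pairwise_sort _ _) (Multiset.pairwise_sort _ _)
      (by simpa using hc) h]

lemma exists_multisetRank_eq {t a : ℕ} (h : t ≠ 0 ∨ a = 0) :
    ∃ M : Multiset ℕ, M.card = t ∧ multisetRank M = a := by
  obtain ⟨l, hl, -, hlen, hr⟩ := exists_lexRank_eq t (a + 1) a (by
    cases t with
    | zero => simp_all
    | succ t => exact (lt_choose_add_two a t).trans_le (Nat.choose_le_choose _ (by omega)))
  refine ⟨l, hlen, ?_⟩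
  rw [multisetRank, ← hr]
  congr 1
  refine List.Perm.eq_of_pairwise' (r := (· ≥ ·)) (Multiset.pairwise_sort _ _) hl ?_
  rw [← Multiset.coe_eq_coe, Multiset.sort_eq]

/-! ## The lexicographic ideal with a prescribed Hilbert function -/

/-- The multiset of variables, other than `x₀`, of a monomial; `x_{i+1}` is listed as `i`. -/
def tailVars {n : ℕ} (m : Mon n) : Multiset ℕ :=
  ∑ i : Fin n, Multiset.replicate (m i.succ) (i : ℕ)

lemma tailVars_add {n : ℕ} (m m' : Mon n) : tailVars (m + m') = tailVars m + tailVars m' := by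
  simp [tailVars, Multiset.replicate_add, Finset.sum_add_distrib]

lemma tailVars_single_succ {n : ℕ} (i : Fin n) :
    tailVars (Pi.single i.succ 1 : Mon n) = {(i : ℕ)} := by
  rw [tailVars, Finset.sum_eq_single i]
  · simp
  · intro j _ hj
    simp [hj]
  · simp

lemma tailVars_single_zero {n : ℕ} (k : ℕ) : tailVars (Pi.single 0 k : Mon n) = 0 := by
  simp [tailVars]

lemma mdeg_eq_add_card {n : ℕ} (m : Mon n) : mdeg m = m 0 + (tailVars m).card := by
  simp [mdeg, tailVars, Fin.sum_univ_succ]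

lemma count_tailVars {n : ℕ} (m : Mon n) (i : Fin n) :
    (tailVars m).count (i : ℕ) = m i.succ := by
  simp only [tailVars, Multiset.count_sum', Multiset.count_replicate, Fin.val_inj]
  simp

lemma lt_of_mem_tailVars {n : ℕ} {m : Mon n} {e : ℕ} (h : e ∈ tailVars m) : e < n := by
  obtain ⟨i, -, hi⟩ := Multiset.mem_sum.1 h
  rw [Multiset.eq_of_mem_replicate hi]
  exact i.2

lemma exists_tailVars_eq {n : ℕ} {M : Multiset ℕ} (hM : ∀ e ∈ M, e < n) (c : ℕ) :
    ∃ m : Mon n, tailVars m = M ∧ m 0 = c := by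
  refine ⟨Fin.cons c fun i => M.count (i : ℕ), ?_, rfl⟩
  ext e
  by_cases he : e < n
  · exact count_tailVars _ ⟨e, he⟩
  · rw [Multiset.count_eq_zero_of_notMem fun h => he (lt_of_mem_tailVars h),
      Multiset.count_eq_zero_of_notMem fun h => he (hM e h)]

lemma tailVars_ext {n : ℕ} {m m' : Mon n} (h : tailVars m = tailVars m') (h₀ : m 0 = m' 0) :
    m = m' := by
  funext i
  refine Fin.cases h₀ (fun i => ?_) i
  rw [← count_tailVars m, ← count_tailVars m', h]

lemma eq_shrinkAt_add_single {n : ℕ} (m : Mon n) {j : Fin (n + 1)} (hj : 1 ≤ m j) :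
    m = shrinkAt m j + Pi.single j 1 := by
  funext l
  by_cases h : l = j
  · subst h; simp [shrinkAt]; omega
  · simp [shrinkAt, h]

lemma borelStep_eq_shrinkAt_add_single {n : ℕ} (m : Mon n) {j i : Fin (n + 1)} (h : j ≠ i) :
    borelStep m j i = shrinkAt m j + Pi.single i 1 := by
  funext l
  by_cases h₁ : l = j
  · subst h₁; simp [shrinkAt, borelStep, h]
  · by_cases h₂ : l = i
    · subst h₂; simp [shrinkAt, borelStep, h₁]
    · simp [shrinkAt, borelStep, h₁, h₂]

lemma ite_add_eq_add_single {n : ℕ} (m : Mon n) (i : Fin (n + 1)) (k : ℕ) :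
    (fun l => if l = i then m l + k else m l) = m + Pi.single i k := by
  funext l
  by_cases h : l = i
  · subst h; simp
  · simp [h]

/-- The ideal generated by the lexicographically largest monomials in `x₁, …, xₙ` whose
Hilbert function in these variables is `v`. -/
def lexIdeal (n : ℕ) (v : ℕ → ℕ) : Set (Mon n) :=
  {m | v (tailVars m).card ≤ multisetRank (tailVars m)}

lemma stronglyStable_lexIdeal (n : ℕ) {v : ℕ → ℕ} (h₀ : v 0 = 1)
    (hv : ∀ t, 1 ≤ t → v (t + 1) ≤ plusPlus (v t) t) : StronglyStable (lexIdeal n v) := by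
  have hideal : MonIdeal (lexIdeal n v) := fun m hm m' => by
    rw [lexIdeal, Set.mem_ofPred_eq, tailVars_add]
    exact le_multisetRank_add h₀ hv _ hm
  refine ⟨hideal, fun m hm j i hji hj => ?_⟩
  obtain ⟨i, rfl⟩ := Fin.exists_succ_eq.2 ((Fin.zero_le j).trans_lt hji).ne'
  rw [borelStep_eq_shrinkAt_add_single m hji.ne]
  rw [eq_shrinkAt_add_single m hj] at hm
  rcases Fin.eq_zero_or_eq_succ j with rfl | ⟨j, rfl⟩
  · refine hideal _ ?_ _
    simpa [lexIdeal, tailVars_add, tailVars_single_zero] using hm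
  · simp only [lexIdeal, Set.mem_ofPred_eq, tailVars_add, tailVars_single_succ,
      Multiset.card_add, Multiset.card_singleton] at hm ⊢
    refine hm.trans ?_
    rw [Multiset.add_comm, Multiset.singleton_add, Multiset.add_comm, Multiset.singleton_add]
    exact multisetRank_cons_mono _ (Fin.succ_lt_succ_iff.1 hji).le

lemma monSat_lexIdeal (n : ℕ) (v : ℕ → ℕ) : monSat (lexIdeal n v) = lexIdeal n v := by
  refine Set.Subset.antisymm (fun m hm => ?_) fun m hm i => ⟨0, by simpa using hm⟩
  obtain ⟨k, hk⟩ := hm 0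
  rw [ite_add_eq_add_single] at hk
  simpa [lexIdeal, tailVars_add, tailVars_single_zero] using hk

lemma hilb_lexIdeal {v : ℕ → ℕ} (h₀ : v 0 = 1)
    (hv : ∀ t, 1 ≤ t → v (t + 1) ≤ plusPlus (v t) t) (t : ℕ) :
    hilb (lexIdeal (v 1) v) t = ∑ d ∈ Finset.range (t + 1), v d := by
  have hcard : ((Finset.range (t + 1)).sigma fun d => Finset.range (v d)).card =
      ∑ d ∈ Finset.range (t + 1), v d := by simp
  rw [hilb, ← hcard, ← Set.ncard_coe_finset]
  refine Set.ncard_congr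
    (fun m _ => (⟨(tailVars m).card, multisetRank (tailVars m)⟩ : Σ _ : ℕ, ℕ)) ?_ ?_ ?_
  · rintro m ⟨hm, hmJ⟩
    rw [mdeg_eq_add_card] at hm
    rw [lexIdeal, Set.mem_ofPred_eq, not_le] at hmJ
    simpa [hmJ] using by omega
  · rintro m m' ⟨hm, -⟩ ⟨hm', -⟩ h
    rw [mdeg_eq_add_card] at hm hm'
    simp only [Sigma.mk.injEq, heq_eq_eq] at h
    exact tailVars_ext (multisetRank_injective h.1 h.2) (by omega)
  · rintro ⟨d, r⟩ h
    simp only [Finset.coe_sigma, Set.mem_sigma_iff, Finset.coe_range, Set.mem_Iio] at h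
    obtain ⟨M, rfl, rfl⟩ := exists_multisetRank_eq (t := d) (a := r) (by
      rcases eq_or_ne d 0 with rfl | hd
      · right; omega
      · exact Or.inl hd)
    have hM : ∀ e ∈ M, e < v 1 := by
      intro e he
      by_contra hlt
      have := le_multisetRank_add h₀ hv (M := {e}) (M.erase e) (by
        simpa [multisetRank, lexRank] using hlt)
      rw [Multiset.singleton_add, Multiset.cons_erase he] at this
      omega
    obtain ⟨m, rfl, hm⟩ := exists_tailVars_eq hM (t - M.card)
    refine ⟨m, ⟨?_, ?_⟩, rfl⟩
    · rw [mdeg_eq_add_card]; omega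
    · rw [lexIdeal, Set.mem_ofPred_eq]; omega

lemma exists_saturated_stronglyStable {u : ℕ → ℤ} (hu : OSeq u) (hu' : OSeq (nderiv u)) :
    ∃ (n : ℕ) (J : Set (Mon n)), StronglyStable J ∧ monSat J = J ∧
      ∀ t : ℕ, (hilb J t : ℤ) = u t := by
  set v : ℕ → ℕ := fun t => (nderiv u t).toNat
  have hcast : ∀ t, (v t : ℤ) = nderiv u t := fun t => Int.toNat_of_nonneg (hu'.1 t)
  have h₀ : v 0 = 1 := rfl
  have hv : ∀ t, 1 ≤ t → v (t + 1) ≤ plusPlus (v t) t := fun t ht => by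
    have := hu'.2.2 t ht
    rw [← hcast] at this
    exact_mod_cast this
  refine ⟨v 1, lexIdeal (v 1) v, stronglyStable_lexIdeal _ h₀ hv, monSat_lexIdeal _ _,
    fun t => ?_⟩
  rw [hilb_lexIdeal h₀ hv, Nat.cast_sum]
  induction t with
  | zero => simp [h₀, hu.2.1]
  | succ t ih => rw [Finset.sum_range_succ, ih, hcast, nderiv]; ring

/-! ## Minimal generators and regularity -/

lemma isAntichain_isMinGen {n : ℕ} {J : Set (Mon n)} (hJ : MonIdeal J) :
    IsAntichain (· ≤ ·) {m : Mon n | IsMinGen J m} := by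
  intro a ha b hb hab hle
  obtain ⟨i, hi⟩ : ∃ i, a i < b i := by
    by_contra! h
    exact hab (le_antisymm hle h)
  have hle' : a ≤ shrinkAt b i := fun l => by
    by_cases h : l = i
    · subst h; simp only [shrinkAt, if_true]; omega
    · simpa [shrinkAt, h] using hle l
  exact hb.2 i (by omega) (add_tsub_cancel_of_le hle' ▸ hJ a ha.1 (shrinkAt b i - a))

lemma exists_shrinkAt_mem {n : ℕ} {J : Set (Mon n)} (hJ : MonIdeal J) {m : Mon n} (hm : m ∈ J)
    (h : monReg J < mdeg m) : ∃ i, 1 ≤ m i ∧ shrinkAt m i ∈ J := by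
  by_contra! hgen
  have hfin : {m : Mon n | IsMinGen J m}.Finite :=
    WellQuasiOrderedLE.finite_of_isAntichain (isAntichain_isMinGen hJ)
  exact h.not_ge (le_csSup (hfin.image mdeg).bddAbove ⟨m, ⟨hm, hgen⟩, rfl⟩)

lemma shrinkAt_add_single {n : ℕ} (m : Mon n) (i : Fin (n + 1)) :
    shrinkAt (m + Pi.single i 1) i = m := by
  funext l
  by_cases h : l = i
  · subst h; simp [shrinkAt]
  · simp [shrinkAt, h]

lemma mdeg_add_single {n : ℕ} (m : Mon n) (i : Fin (n + 1)) :
    mdeg (m + Pi.single i 1) = mdeg m + 1 := by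
  simp [mdeg, Finset.sum_add_distrib]

lemma mem_of_add_single_mem {n : ℕ} {J : Set (Mon n)} (hJ : StronglyStable J) {m : Mon n}
    {i : Fin (n + 1)} (hi : ∀ j < i, m j = 0) (hdeg : monReg J ≤ mdeg m)
    (hm : m + Pi.single i 1 ∈ J) : m ∈ J := by
  obtain ⟨l, hl, hlJ⟩ := exists_shrinkAt_mem hJ.1 hm (by rw [mdeg_add_single]; omega)
  rcases lt_trichotomy l i with h | rfl | h
  · simp [hi l h, h.ne] at hl
  · rwa [shrinkAt_add_single] at hlJ
  · have := hJ.2 _ hlJ i l h (by simp [shrinkAt, h.ne])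
    rw [borelStep_eq_shrinkAt_add_single _ h.ne] at this
    convert this using 1
    funext a
    by_cases h₁ : a = i
    · subst h₁; simp [shrinkAt, h.ne]
    · by_cases h₂ : a = l
      · subst h₂; simp [shrinkAt, h.ne'] at hl ⊢; omega
      · simp [shrinkAt, h₁, h₂]

lemma mem_of_add_single_zero_mem {n : ℕ} {J : Set (Mon n)} (hJ : StronglyStable J)
    (hsat : monSat J = J) {m : Mon n} (hm : m + Pi.single 0 1 ∈ J) : m ∈ J := by
  rw [← hsat]
  intro i
  refine ⟨1, ?_⟩
  rw [ite_add_eq_add_single]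
  rcases eq_or_ne i 0 with rfl | hi
  · exact hm
  · have := hJ.2 _ hm 0 i (Fin.pos_of_ne_zero hi) (by simp)
    rwa [borelStep_eq_shrinkAt_add_single _ hi.symm, shrinkAt_add_single] at this

/-! ## Hilbert functions after killing the smallest variables -/

/-- The number of monomials of degree `t` in the variables `x_k, …, x_n` outside `J`. -/
noncomputable def restrictedHilb {n : ℕ} (J : Set (Mon n)) (k t : ℕ) : ℕ :=
  Set.ncard {m : Mon n | mdeg m = t ∧ m ∉ J ∧ ∀ j : Fin (n + 1), (j : ℕ) < k → m j = 0}

lemma finite_mdeg_eq (n t : ℕ) : {m : Mon n | mdeg m = t}.Finite := by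
  refine (Set.finite_Iic (fun _ => t : Mon n)).subset fun m hm i => ?_
  rw [← show mdeg m = t from hm]
  exact Finset.single_le_sum (fun _ _ => Nat.zero_le _) (Finset.mem_univ i)

lemma restrictedHilb_zero {n : ℕ} (J : Set (Mon n)) (t : ℕ) :
    restrictedHilb J 0 t = hilb J t := by
  simp [restrictedHilb, hilb]

lemma restrictedHilb_eq_zero {n : ℕ} (J : Set (Mon n)) {k t : ℕ} (hk : n + 1 ≤ k)
    (ht : 1 ≤ t) : restrictedHilb J k t = 0 := by
  rw [restrictedHilb, Set.ncard_eq_zero ((finite_mdeg_eq n t).subset fun m hm => hm.1)]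
  refine Set.eq_empty_of_forall_notMem fun m ⟨hm, _, h⟩ => ?_
  have : mdeg m = 0 := Finset.sum_eq_zero fun i _ => h i (i.2.trans_le hk)
  omega

lemma restrictedHilb_succ_eq_add_ncard {n : ℕ} {J : Set (Mon n)} (i : Fin (n + 1)) (t : ℕ) :
    restrictedHilb J i (t + 1) = restrictedHilb J (i + 1) (t + 1) +
      Set.ncard {m : Mon n | mdeg m = t ∧ m + Pi.single i 1 ∉ J ∧ ∀ j < i, m j = 0} := by
  rw [restrictedHilb, restrictedHilb,
    ← Set.ncard_image_of_injective {m : Mon n | mdeg m = t ∧ _ ∧ _}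
      (add_left_injective (Pi.single i 1 : Mon n)),
    ← Set.ncard_union_eq (Set.disjoint_left.2 ?_)
      ((finite_mdeg_eq n (t + 1)).subset fun m hm => hm.1)
      (((finite_mdeg_eq n t).subset fun m hm => hm.1).image _)]
  · congr 1
    ext m
    constructor
    · rintro ⟨hm, hmJ, h⟩
      rcases Nat.eq_zero_or_pos (m i) with hi | hi
      · refine Or.inl ⟨hm, hmJ, fun j hj => ?_⟩
        rcases Nat.lt_succ_iff_lt_or_eq.1 hj with hj | hj
        · exact h j hj
        · rwa [Fin.ext hj]
      · have hmi := eq_shrinkAt_add_single m hi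
        refine Or.inr ⟨shrinkAt m i, ⟨?_, hmi ▸ hmJ, fun j hj => ?_⟩, hmi.symm⟩
        · rw [hmi, mdeg_add_single] at hm
          omega
        · simp [shrinkAt, hj.ne, h j hj]
    · rintro (⟨hm, hmJ, h⟩ | ⟨m, ⟨rfl, hmJ, h⟩, rfl⟩)
      · exact ⟨hm, hmJ, fun j hj => h j (by omega)⟩
      · refine ⟨mdeg_add_single m i, hmJ, fun j hj => ?_⟩
        have hj' : j < i := hj
        simp [h j hj', hj'.ne]
  · rintro _ ⟨-, -, h⟩ ⟨m, -, rfl⟩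
    simpa using h i (Nat.lt_succ_self _)

lemma restrictedHilb_succ_le {n : ℕ} {J : Set (Mon n)} (hJ : MonIdeal J) (k : ℕ) {t : ℕ} :
    restrictedHilb J k (t + 1) ≤ restrictedHilb J (k + 1) (t + 1) + restrictedHilb J k t := by
  rcases lt_or_ge k (n + 1) with hk | hk
  · rw [restrictedHilb_succ_eq_add_ncard ⟨k, hk⟩ t]
    refine Nat.add_le_add_left (Set.ncard_le_ncard ?_
      ((finite_mdeg_eq n t).subset fun m hm => hm.1)) _
    exact fun m ⟨hm, hmJ, h⟩ => ⟨hm, fun hJm => hmJ (hJ m hJm _), h⟩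
  · simp [restrictedHilb_eq_zero J hk]

lemma restrictedHilb_succ_eq {n : ℕ} {J : Set (Mon n)} (hJ : StronglyStable J) (k : ℕ) {t : ℕ}
    (ht : 1 ≤ t) (hreg : monReg J ≤ t) :
    restrictedHilb J k (t + 1) = restrictedHilb J (k + 1) (t + 1) + restrictedHilb J k t := by
  refine le_antisymm (restrictedHilb_succ_le hJ.1 k) ?_
  rcases lt_or_ge k (n + 1) with hk | hk
  · rw [restrictedHilb_succ_eq_add_ncard ⟨k, hk⟩ t]
    refine Nat.add_le_add_left (Set.ncard_le_ncard ?_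
      ((finite_mdeg_eq n t).subset fun m hm => hm.1)) _
    exact fun m ⟨hm, hmJ, h⟩ =>
      ⟨hm, fun hJm => hmJ (mem_of_add_single_mem hJ h (hm ▸ hreg) hJm), h⟩
  · simp [restrictedHilb_eq_zero J hk ht, restrictedHilb_eq_zero J (hk.trans k.le_succ)]

lemma hilb_succ_eq {n : ℕ} {J : Set (Mon n)} (hJ : StronglyStable J) (hsat : monSat J = J)
    (t : ℕ) : hilb J (t + 1) = restrictedHilb J 1 (t + 1) + hilb J t := by
  rw [← restrictedHilb_zero, ← restrictedHilb_zero]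
  refine le_antisymm (restrictedHilb_succ_le hJ.1 0) ?_
  have := restrictedHilb_succ_eq_add_ncard (J := J) 0 t
  rw [Fin.val_zero] at this
  rw [this]
  refine Nat.add_le_add_left (Set.ncard_le_ncard ?_
    ((finite_mdeg_eq n t).subset fun m hm => hm.1)) _
  exact fun m ⟨hm, hmJ, h⟩ => ⟨hm, fun hJm => hmJ (mem_of_add_single_zero_mem hJ hsat hJm), h⟩

/-! ## Functions with eventually vanishing differences -/

lemma fwdDiff_iter_congr {f g : ℕ → ℚ} {s : ℕ} (h : ∀ t, s ≤ t → f t = g t) (d : ℕ) {t : ℕ}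
    (ht : s ≤ t) : (fwdDiff 1)^[d] f t = (fwdDiff 1)^[d] g t := by
  rw [fwdDiff_iter_eq_sum_shift, fwdDiff_iter_eq_sum_shift]
  exact Finset.sum_congr rfl fun k _ => by rw [h _ (by omega)]

lemma fwdDiff_iter_eq_zero_of_le {f : ℕ → ℚ} {s d e : ℕ}
    (h : ∀ t, s ≤ t → (fwdDiff 1)^[d] f t = 0) (hde : d ≤ e) {t : ℕ} (ht : s ≤ t) :
    (fwdDiff 1)^[e] f t = 0 := by
  obtain ⟨e, rfl⟩ := Nat.exists_eq_add_of_le' hde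
  rw [Function.iterate_add_apply, fwdDiff_iter_eq_sum_shift]
  exact Finset.sum_eq_zero fun k _ => by rw [h _ (by omega), smul_zero]

lemma fwdDiff_iter_eval_natCast (Q : Polynomial ℚ) (t : ℕ) :
    (fwdDiff 1)^[Q.natDegree + 1] (fun t : ℕ => Q.eval (t : ℚ)) t = 0 := by
  have := congrFun Q.fwdDiff_iter_degree_add_one_eq_zero (t : ℚ)
  rw [fwdDiff_iter_eq_sum_shift] at this ⊢
  simpa using this

/-- If `f` has vanishing differences from `s` on and agrees with a polynomial beyond `s`,
then it agrees with it also at `s`. -/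
lemma eq_eval_of_fwdDiff_iter_eq_zero {f : ℕ → ℚ} {s d : ℕ}
    (hf : ∀ t, s ≤ t → (fwdDiff 1)^[d] f t = 0) (Q : Polynomial ℚ)
    (h : ∀ t : ℕ, s < t → f t = Q.eval (t : ℚ)) : f s = Q.eval (s : ℚ) := by
  have h₁ := fwdDiff_iter_eq_zero_of_le hf (le_max_left d (Q.natDegree + 1)) le_rfl
  have h₂ := fwdDiff_iter_eq_zero_of_le (s := s) (fun t _ => fwdDiff_iter_eval_natCast Q t)
    (le_max_right d (Q.natDegree + 1)) le_rfl
  rw [fwdDiff_iter_eq_sum_shift, Finset.sum_range_succ'] at h₁ h₂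
  have h₃ : ∀ k : ℕ, f (s + (k + 1) • 1) = Q.eval ((s + (k + 1) • 1 : ℕ) : ℚ) :=
    fun k => h _ (by simp)
  simp only [h₃] at h₁
  have h₄ := add_left_cancel (h₁.trans h₂.symm)
  simpa using h₄

lemma fwdDiff_iter_restrictedHilb {n : ℕ} {J : Set (Mon n)} (hJ : StronglyStable J) {s : ℕ}
    (hs : 1 ≤ s) (hreg : monReg J ≤ s) (d : ℕ) :
    ∀ k, n + 1 ≤ k + d → ∀ t, s ≤ t →
      (fwdDiff 1)^[d] (fun t => (restrictedHilb J k t : ℚ)) t = 0 := by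
  induction d with
  | zero =>
    intro k hk t ht
    simp [restrictedHilb_eq_zero J (show n + 1 ≤ k from hk) (hs.trans ht)]
  | succ d ih =>
    intro k hk t ht
    rw [Function.iterate_succ_apply,
      fwdDiff_iter_congr (g := fun t => (restrictedHilb J (k + 1) (t + 1) : ℚ)) _ d ht]
    · rw [fwdDiff_iter_comp_add 1 (fun t => (restrictedHilb J (k + 1) t : ℚ)) 1 d t]
      exact ih (k + 1) (by omega) _ (by omega)
    · intro t ht
      rw [fwdDiff, restrictedHilb_succ_eq hJ k (hs.trans ht) (hreg.trans ht)]
      push_cast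
      ring

lemma add_one_lt_monReg (P : Polynomial ℚ) (u : ℕ → ℤ) {ρ : ℕ} (hρ : 1 ≤ ρ)
    (hP : ∀ t : ℕ, ρ ≤ t → (u t : ℚ) = P.eval (t : ℚ))
    (hgt : P.eval ((ρ : ℚ) - 1) < (u (ρ - 1) : ℚ)) {n : ℕ} {J : Set (Mon n)}
    (hJ : StronglyStable J) (hsat : monSat J = J) (hu : ∀ t : ℕ, (hilb J t : ℤ) = u t) :
    ρ + 1 < monReg J := by
  by_contra! hreg
  have hdiff : ∀ t, (restrictedHilb J 1 (t + 1) : ℚ) = u (t + 1) - u t := fun t => by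
    rw [← hu, ← hu, hilb_succ_eq hJ hsat t]
    push_cast
    ring
  have hsecond := eq_eval_of_fwdDiff_iter_eq_zero
    (f := fun t => (restrictedHilb J 2 (t + 1) : ℚ)) (s := ρ) (d := n + 1)
    (fun t ht => by
      rw [fwdDiff_iter_comp_add 1 (fun t => (restrictedHilb J 2 t : ℚ)) 1]
      exact fwdDiff_iter_restrictedHilb hJ (s := ρ + 1) (by omega) hreg (n + 1) 2 (by omega) _
        (by omega))
    (P.comp (Polynomial.X + 1) - 2 * P + P.comp (Polynomial.X - 1))
    (fun t ht => by
      obtain ⟨t, rfl⟩ := Nat.exists_eq_add_of_le' (show 1 ≤ t by omega)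
      have h := restrictedHilb_succ_eq hJ 1 (t := t + 1) (by omega) (by omega)
      have h' : (restrictedHilb J 2 (t + 1 + 1) : ℚ) =
          restrictedHilb J 1 (t + 1 + 1) - restrictedHilb J 1 (t + 1) := by
        rw [h]; push_cast; ring
      rw [h', hdiff, hdiff, hP _ (by omega), hP _ (by omega), hP _ (by omega)]
      simp
      ring)
  obtain ⟨r, rfl⟩ := Nat.exists_eq_add_of_le' hρ
  have hle : (restrictedHilb J 1 (r + 1 + 1) : ℚ) ≤
      restrictedHilb J 2 (r + 1 + 1) + restrictedHilb J 1 (r + 1) := by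
    exact_mod_cast restrictedHilb_succ_le hJ.1 1 (t := r + 1)
  rw [hdiff, hdiff, hP _ (by omega), hP _ le_rfl] at hle
  simp at hsecond hgt hle
  linarith

/-- Proposition `newreg`.
Let `u` be the Hilbert function of a closed projective subscheme with Hilbert polynomial
`p(z)` and regularity `ρ ≥ 1`, and suppose `u(ρ-1) > p(ρ-1)`. Then every closed projective
subscheme with Hilbert function `u` has Castelnuovo–Mumford regularity `> ρ+1`;
equivalently `m_u ≥ ρ+2`, i.e. every saturated strongly stable ideal `J` with `H_{S/J} = u`
satisfies `reg(J) > ρ+1`. -/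
theorem statement13 (P : Polynomial ℚ) (u : ℕ → ℤ)
    (hu : OSeq u ∧ OSeq (nderiv u)) (ρ : ℕ) (hρ : 1 ≤ ρ)
    (hreg : IsRegPoly P u ρ)
    (hgt : P.eval ((ρ : ℚ) - 1) < (u (ρ - 1) : ℚ)) :
    ρ + 2 ≤ mReg u ∧
    ∀ (n : ℕ) (J : Set (Mon n)), StronglyStable J → monSat J = J →
      (∀ t : ℕ, (hilb J t : ℤ) = u t) → ρ + 1 < monReg J := by
  have hlt : ∀ (n : ℕ) (J : Set (Mon n)), StronglyStable J → monSat J = J →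
      (∀ t : ℕ, (hilb J t : ℤ) = u t) → ρ + 1 < monReg J :=
    fun n J hJ hsat h => add_one_lt_monReg P u hρ hreg.1 hgt hJ hsat h
  refine ⟨?_, hlt⟩
  obtain ⟨n, J, hJ, hsat, h⟩ := exists_saturated_stronglyStable hu.1 hu.2
  refine le_csInf ⟨_, n, J, hJ, hsat, h, rfl⟩ ?_
  rintro r ⟨n, J, hJ, hsat, h, rfl⟩
  exact hlt n J hJ hsat h
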